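/- arXiv:2206.12951 — 8 statements merged into one kernel-verified Lean document; each statement's English description precedes it below -/
import Mathlib

section
/- Let n > 1 and K > 0 be real constants and let Φ_n : ℝ → ℝ be a smooth cutoff function with 0 ≤ Φ_n ≤ 1, Φ_n(r) = 1 for r ≤ n, and Φ_n(r) = 0 for r ≥ n+1. Suppose h is differentiable on an interval [1, r*) with 1 < r* ≤ ∞, h(1) > 0, and h'(r) = h(r)/r − (1/r + (1/2) r K Φ_n(r)²) h(r)² for all r ∈ [1, r*). Set C = 2 + (n+1)² K / 2. Then for every L with 0 < L < min(h(1), 1/C) one has h(r) > L for all r ∈ [1, r*), and for every U with U > max(h(1), 1) one has h(r) < U for all r ∈ [1, r*). -/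
/-- Barrier bounds for solutions of
`h'(r) = h(r)/r − (1/r + (1/2) r K Φ(r)²) h(r)²` on a maximal interval `[1, r*)`,
`1 < r* ≤ ∞`: every `L` with `0 < L < min (h 1) (1/C)` is a lower barrier and every
`U > max (h 1) 1` is an upper barrier, where `C = 2 + (n+1)² K / 2`. -/
theorem barrier_bounds (n K : ℝ) (hn : 1 < n) (hK : 0 < K)
    (Φ : ℝ → ℝ) (hΦsmooth : ContDiff ℝ (⊤ : ℕ∞) Φ)
    (hΦ0 : ∀ r, 0 ≤ Φ r) (hΦ1 : ∀ r, Φ r ≤ 1)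
    (hΦone : ∀ r, r ≤ n → Φ r = 1) (hΦzero : ∀ r, n + 1 ≤ r → Φ r = 0)
    (rstar : EReal) (hrstar : (1 : EReal) < rstar)
    (h : ℝ → ℝ) (hinit : 0 < h 1)
    (hode : ∀ r : ℝ, 1 ≤ r → (r : EReal) < rstar →
      HasDerivWithinAt h
        (h r / r - (1 / r + (1 / 2) * r * K * (Φ r) ^ 2) * (h r) ^ 2)
        (Set.Ici 1) r) :
    (∀ L : ℝ, 0 < L → L < min (h 1) (1 / (2 + (n + 1) ^ 2 * K / 2)) →
      ∀ r : ℝ, 1 ≤ r → (r : EReal) < rstar → L < h r) ∧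
    (∀ U : ℝ, max (h 1) 1 < U →
      ∀ r : ℝ, 1 ≤ r → (r : EReal) < rstar → h r < U) := by
  have lt_of : ∀ x r : ℝ, x ≤ r → (r : EReal) < rstar → (x : EReal) < rstar := fun x r hx hr =>
    lt_of_le_of_lt (EReal.coe_le_coe_iff.mpr hx) hr
  have hcont : ∀ r : ℝ, (r : EReal) < rstar → ContinuousOn h (Set.Icc 1 r) := fun r hr x hx =>
    ((hode x hx.1 (lt_of x r hx.2 hr)).continuousWithinAt).mono Set.Icc_subset_Ici_self
  have hder : ∀ r : ℝ, (r : EReal) < rstar → ∀ x ∈ Set.Ico 1 r,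
      HasDerivWithinAt h (h x / x - (1 / x + (1 / 2) * x * K * (Φ x) ^ 2) * (h x) ^ 2)
        (Set.Ici x) x := fun r hr x hx =>
    (hode x hx.1 (lt_of x r hx.2.le hr)).mono (Set.Ici_subset_Ici.mpr hx.1)
  constructor
  · intro L₀ hL₀ hL₀' r hr1 hr
    obtain ⟨L, hL1, hL2⟩ := exists_between hL₀'
    have hL : 0 < L := hL₀.trans hL1
    have hLh : L < h 1 := lt_of_lt_of_le hL2 (min_le_left _ _)
    have hLC : L < 1 / (2 + (n + 1) ^ 2 * K / 2) := lt_of_lt_of_le hL2 (min_le_right _ _)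
    have hCL : L * (2 + (n + 1) ^ 2 * K / 2) < 1 := by
      rwa [lt_div_iff₀ (by positivity)] at hLC
    have key := image_le_of_deriv_right_lt_deriv_boundary' (f := fun x => - h x)
      (B := fun _ => -L) (B' := fun _ => 0) (hcont r hr).neg
      (fun x hx => (hder r hr x hx).neg) (by simpa using hLh.le) continuousOn_const
      (fun x _ => hasDerivWithinAt_const _ _ _) ?_ (Set.right_mem_Icc.mpr hr1)
    · simp only [neg_le_neg_iff] at key
      exact hL1.trans_le key
    · intro x hx hxL
      have hxL : h x = L := by simpa using hxL
      have hx0 : 0 < x := lt_of_lt_of_le one_pos hx.1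
      rw [hxL, neg_lt_zero]
      have hb : x ^ 2 * Φ x ^ 2 ≤ (n + 1) ^ 2 := by
        rcases le_total (n + 1) x with hnx | hnx
        · rw [hΦzero x hnx]; nlinarith [sq_nonneg (n + 1)]
        · have h1 : x * Φ x ≤ (n + 1) * 1 :=
            mul_le_mul hnx (hΦ1 x) (hΦ0 x) (by linarith)
          have h2 : 0 ≤ x * Φ x := mul_nonneg hx0.le (hΦ0 x)
          nlinarith
      have e : L / x - (1 / x + (1 / 2) * x * K * (Φ x) ^ 2) * L ^ 2
          = L / x * (1 - L * (1 + (x ^ 2 * Φ x ^ 2) * K / 2)) := by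
        field_simp
      rw [e]
      refine mul_pos (by positivity) ?_
      have h3 : L * (1 + (x ^ 2 * Φ x ^ 2) * K / 2) ≤ L * (2 + (n + 1) ^ 2 * K / 2) := by
        gcongr
        norm_num
      linarith
  · intro U₀ hU₀ r hr1 hr
    obtain ⟨U, hU1, hU2⟩ := exists_between hU₀
    have hUh : h 1 < U := lt_of_le_of_lt (le_max_left _ _) hU1
    have hU : 1 < U := lt_of_le_of_lt (le_max_right _ _) hU1
    have key := image_le_of_deriv_right_lt_deriv_boundary' (f := h)
      (B := fun _ => U) (B' := fun _ => 0) (hcont r hr)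
      (hder r hr) hUh.le continuousOn_const
      (fun x _ => hasDerivWithinAt_const _ _ _) ?_ (Set.right_mem_Icc.mpr hr1)
    · exact lt_of_le_of_lt key hU2
    · intro x hx hxU
      have hxU : h x = U := hxU
      have hx0 : 0 < x := lt_of_lt_of_le one_pos hx.1
      rw [hxU]
      have e : U / x - (1 / x + (1 / 2) * x * K * (Φ x) ^ 2) * U ^ 2
          = - (U / x * (U - 1)) - (1 / 2) * x * K * (Φ x) ^ 2 * U ^ 2 := by
        field_simp
        ring
      have h1 : 0 < U / x * (U - 1) := mul_pos (by positivity) (by linarith)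
      have h2 : 0 ≤ (1 / 2) * x * K * (Φ x) ^ 2 * U ^ 2 := by positivity
      linarith
end

section
/- Let n > 1 and K > 0 be real constants and let Φ_n : ℝ → ℝ be a smooth cutoff function with 0 ≤ Φ_n ≤ 1, Φ_n(r) = 1 for r ≤ n, and Φ_n(r) = 0 for r ≥ n+1. Then for every initial value a > 0 there exists a unique smooth function h : [1, ∞) → ℝ with h(1) = a satisfying h'(r) = h(r)/r − (1/r + (1/2) r K Φ_n(r)²) h(r)² for all r ≥ 1; moreover h(r) > 0 for all r ≥ 1. -/
/-- For every `a > 0` the ODE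
`h'(r) = h(r)/r − (1/r + (1/2) r K Φ(r)²) h(r)²` has a unique smooth solution on
`[1, ∞)` with `h(1) = a`, and this solution is everywhere positive. -/
theorem global_existence_uniqueness (n K : ℝ) (hn : 1 < n) (hK : 0 < K)
    (Φ : ℝ → ℝ) (hΦsmooth : ContDiff ℝ (⊤ : ℕ∞) Φ)
    (hΦ0 : ∀ r, 0 ≤ Φ r) (hΦ1 : ∀ r, Φ r ≤ 1)
    (hΦone : ∀ r, r ≤ n → Φ r = 1) (hΦzero : ∀ r, n + 1 ≤ r → Φ r = 0) :
    ∀ a : ℝ, 0 < a → ∃ h : ℝ → ℝ,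
      ContDiffOn ℝ (⊤ : ℕ∞) h (Set.Ici 1) ∧
      h 1 = a ∧
      (∀ r : ℝ, 1 ≤ r →
        HasDerivWithinAt h
          (h r / r - (1 / r + (1 / 2) * r * K * (Φ r) ^ 2) * (h r) ^ 2)
          (Set.Ici 1) r) ∧
      (∀ r : ℝ, 1 ≤ r → 0 < h r) ∧
      (∀ g : ℝ → ℝ, g 1 = a →
        (∀ r : ℝ, 1 ≤ r →
          HasDerivWithinAt g
            (g r / r - (1 / r + (1 / 2) * r * K * (Φ r) ^ 2) * (g r) ^ 2)
            (Set.Ici 1) r) →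
        Set.EqOn g h (Set.Ici 1)) := by
  intro a ha
  set f : ℝ → ℝ := fun s => 1 + (1 / 2) * s ^ 2 * K * (Φ s) ^ 2 with hf
  have hfs : ContDiff ℝ (⊤ : ℕ∞) f := by
    rw [hf]; fun_prop
  have hfc : Continuous f := hfs.continuous
  set u : ℝ → ℝ := fun r => 1 / a + ∫ s in (1 : ℝ)..r, f s with hu
  have hu' : ∀ r, HasDerivAt u (f r) r := fun r =>
    (intervalIntegral.integral_hasDerivAt_right (hfc.intervalIntegrable _ _)
      hfc.stronglyMeasurable.stronglyMeasurableAtFilter hfc.continuousAt).const_add _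
  have hderiv : deriv u = f := funext fun r => (hu' r).deriv
  have hus : ContDiff ℝ (⊤ : ℕ∞) u := by
    rw [contDiff_infty_iff_deriv, hderiv]
    exact ⟨fun r => (hu' r).differentiableAt, hfs⟩
  have hupos : ∀ r, 1 ≤ r → 0 < u r := by
    intro r hr
    have h1 : 0 ≤ ∫ s in (1 : ℝ)..r, f s :=
      intervalIntegral.integral_nonneg hr (fun s _ => by simp only [hf]; positivity)
    have h2 : 0 < 1 / a := by positivity
    simp only [hu]; linarith
  have hu1 : u 1 = 1 / a := by simp [hu]
  clear_value u
  refine ⟨fun r => r / u r, ?_, ?_, ?_, ?_, ?_⟩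
  · exact contDiffOn_id.div hus.contDiffOn (fun r hr => (hupos r hr).ne')
  · simp [hu1]
  · intro r hr
    have hu0 := (hupos r hr).ne'
    have hr0 : r ≠ 0 := by linarith
    have := ((hasDerivAt_id r).div (hu' r) hu0).hasDerivWithinAt (s := Set.Ici 1)
    refine this.congr_deriv ?_
    simp only [hf, id]
    field_simp
  · intro r hr
    exact div_pos (by linarith) (hupos r hr)
  · intro g hg1 hg b hb
    have hb1 : (1 : ℝ) ≤ b := hb
    have hgc : ContinuousOn g (Set.Icc 1 b) := fun r hr =>
      ((hg r hr.1).continuousWithinAt).mono Set.Icc_subset_Ici_self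
    set k : ℝ → ℝ := fun r => 1 / r - (1 / r + (1 / 2) * r * K * (Φ r) ^ 2) * g r with hk
    have hΦc : Continuous Φ := hΦsmooth.continuous
    have hkc : ContinuousOn k (Set.Icc 1 b) := by
      have h1 : ContinuousOn (fun r : ℝ => 1 / r) (Set.Icc 1 b) :=
        continuousOn_const.div continuousOn_id (fun r hr => by
          have := hr.1
          linarith)
      have h2 : ContinuousOn (fun r : ℝ => (1 / 2) * r * K * (Φ r) ^ 2) (Set.Icc 1 b) := by
        fun_prop
      exact h1.sub ((h1.add h2).mul hgc)
    obtain ⟨M, hM⟩ := isCompact_Icc.exists_bound_of_continuousOn hkc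
    have hp : ∀ r, 1 ≤ r →
        HasDerivWithinAt (fun r => g r * u r - r) (k r * (g r * u r - r)) (Set.Ici 1) r := by
      intro r hr
      have hr0 : r ≠ 0 := by linarith
      refine (((hg r hr).mul (hu' r).hasDerivWithinAt).sub
        (hasDerivWithinAt_id r _)).congr_deriv ?_
      simp only [hf, hk]
      field_simp
      ring
    have key := norm_le_gronwallBound_of_norm_deriv_right_le
      (f := fun r => g r * u r - r) (f' := fun r => k r * (g r * u r - r))
      (δ := 0) (K := M) (ε := 0) (a := 1) (b := b)
      (fun r hr => ((hp r hr.1).continuousWithinAt).mono Set.Icc_subset_Ici_self)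
      (fun r hr => (hp r hr.1).mono (Set.Ici_subset_Ici.2 hr.1))
      (by
        have : a * (1 / a) - 1 = 0 := by field_simp; ring
        simp only [hg1, hu1, this, norm_zero, le_refl])
      (fun r hr => by
        rw [norm_mul, add_zero]
        exact mul_le_mul_of_nonneg_right (hM r ⟨hr.1, hr.2.le⟩) (norm_nonneg _))
      b ⟨hb1, le_rfl⟩
    rw [gronwallBound_ε0_δ0] at key
    have h0 : g b * u b - b = 0 := norm_le_zero_iff.1 key
    have hu0 := (hupos b hb1).ne'
    show g b = b / u b
    rw [eq_div_iff hu0]; linarith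
end

section
/- Let n > 1 and K > 0 be real constants, let Φ_n : ℝ → ℝ be a smooth cutoff function with 0 ≤ Φ_n ≤ 1, Φ_n(r) = 1 for r ≤ n, and Φ_n(r) = 0 for r ≥ n+1, and let h : [1, ∞) → ℝ be the unique positive smooth solution of h'(r) = h(r)/r − (1/r + (1/2) r K Φ_n(r)²) h(r)² with h(1) = a > 0. Then for every integer k ≥ 0 there exists a constant C_k > 0 such that |(d/dr)^k (h(r) − 1)| ≤ C_k / r^{1+k} for all r ∈ [1, ∞). -/
/-- The unique positive smooth solution of the cutoff ODE with
`h(1) = a > 0` satisfies the asymptotic-flatness fall-off conditions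
`|(d/dr)^k (h(r) − 1)| ≤ C_k / r^(1+k)` on `[1, ∞)` for every `k ≥ 0`. -/
theorem solution_falloff (n K : ℝ) (hn : 1 < n) (hK : 0 < K)
    (Φ : ℝ → ℝ) (hΦsmooth : ContDiff ℝ (⊤ : ℕ∞) Φ)
    (hΦ0 : ∀ r, 0 ≤ Φ r) (hΦ1 : ∀ r, Φ r ≤ 1)
    (hΦone : ∀ r, r ≤ n → Φ r = 1) (hΦzero : ∀ r, n + 1 ≤ r → Φ r = 0)
    (a : ℝ) (ha : 0 < a) (h : ℝ → ℝ)
    (hsmooth : ContDiffOn ℝ (⊤ : ℕ∞) h (Set.Ici 1))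
    (hinit : h 1 = a)
    (hpos : ∀ r : ℝ, 1 ≤ r → 0 < h r)
    (hode : ∀ r : ℝ, 1 ≤ r →
      HasDerivWithinAt h
        (h r / r - (1 / r + (1 / 2) * r * K * (Φ r) ^ 2) * (h r) ^ 2)
        (Set.Ici 1) r) :
    ∀ k : ℕ, ∃ C : ℝ, 0 < C ∧ ∀ r : ℝ, 1 ≤ r →
      |iteratedDerivWithin k (fun s => h s - 1) (Set.Ici 1) r| ≤ C / r ^ (1 + k) := by
  set M : ℝ := n + 1 with hM
  have hM1 : 1 < M := by linarith
  have hMpos : 0 < M := by linarith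
  obtain ⟨c, hc⟩ : ∃ c : ℝ, ∀ r, M ≤ r → r / h r - r = c := by
    refine ⟨M / h M - M, fun r hr => ?_⟩
    have hd : ∀ x, M ≤ x → HasDerivWithinAt (fun s => s / h s - s) 0 (Set.Ici 1) x := by
      intro x hx
      have h1x : 1 ≤ x := by linarith
      have hx0 : x ≠ 0 := by linarith
      have hh := (hpos x h1x).ne'
      have := ((hasDerivWithinAt_id x (Set.Ici 1)).div (hode x h1x) hh).sub
        (hasDerivWithinAt_id x (Set.Ici 1))
      refine this.congr_deriv ?_
      rw [hΦzero x hx]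
      simp only [id]
      field_simp
      ring
    refine constant_of_has_deriv_right_zero (f := fun s => s / h s - s) (a := M) (b := r)
      ?_ ?_ r ⟨hr, le_rfl⟩
    · intro x hx
      exact ((hd x hx.1).continuousWithinAt).mono (fun y hy => by
        have := hy.1; simp only [Set.mem_Ici]; linarith)
    · intro x hx
      exact (hd x hx.1).mono (fun y hy => by
        have := hx.1; simp only [Set.mem_Ici] at hy ⊢; linarith)
  have hrc : ∀ r, M ≤ r → 0 < r + c ∧ h r = r / (r + c) := by
    intro r hr
    have h0 := hpos r (by linarith)
    have e : r + c = r / h r := by rw [← hc r hr]; ring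
    have hr0 : 0 < r := by linarith
    rw [e]
    refine ⟨by positivity, ?_⟩
    field_simp
  have key : ∀ k : ℕ, ∀ r, M < r →
      iteratedDerivWithin k (fun s => h s - 1) (Set.Ici 1) r
        = (-1) ^ k * (k.factorial : ℝ) * (-c) / (r + c) ^ (k + 1) := by
    intro k
    induction k with
    | zero =>
      intro r hr
      obtain ⟨h1, h2⟩ := hrc r hr.le
      simp only [iteratedDerivWithin_zero, h2]
      have := h1.ne'
      field_simp
      simp
    | succ k ih =>
      intro r hr
      have hp := (hrc r hr.le).1
      rw [iteratedDerivWithin_succ,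
        derivWithin_of_mem_nhds (Ici_mem_nhds (by linarith))]
      have hev : iteratedDerivWithin k (fun s => h s - 1) (Set.Ici 1) =ᶠ[nhds r]
          fun r => (-1) ^ k * (k.factorial : ℝ) * (-c) / (r + c) ^ (k + 1) := by
        filter_upwards [Ioi_mem_nhds hr] with x hx using ih x hx
      rw [hev.deriv_eq]
      have hd : HasDerivAt (fun x : ℝ => (x + c) ^ (k + 1)) (((k + 1 : ℕ) : ℝ) * (r + c) ^ k * 1) r := by
        exact ((hasDerivAt_id r).add_const c).pow (k + 1)
      have hd2 := (hasDerivAt_const r ((-1) ^ k * (k.factorial : ℝ) * (-c))).div hd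
        (pow_pos hp _).ne'
      refine hd2.deriv.trans ?_
      have := hp.ne'
      rw [Nat.factorial_succ]
      push_cast
      field_simp
      ring
  obtain ⟨B, hB, hBb⟩ : ∃ B : ℝ, 0 < B ∧ ∀ r, M ≤ r → r / (r + c) ≤ B := by
    refine ⟨1 + M / (M + c), ?_, ?_⟩
    · have := (hrc M le_rfl).1
      positivity
    · intro r hr
      have h1 := (hrc M le_rfl).1
      have h2 := (hrc r hr).1
      rcases le_total 0 c with h0 | h0
      · have : r / (r + c) ≤ 1 := by rw [div_le_one h2]; linarith
        have : 0 < M / (M + c) := by positivity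
        linarith
      · have : r / (r + c) ≤ M / (M + c) := by
          rw [div_le_div_iff₀ h2 h1]; nlinarith
        linarith
  intro k
  have hcont : ContinuousOn (iteratedDerivWithin k (fun s => h s - 1) (Set.Ici 1))
      (Set.Icc 1 (M + 1)) := by
    have hs : ContDiffOn ℝ (⊤ : ℕ∞) (fun s => h s - 1) (Set.Ici 1) :=
      hsmooth.sub contDiffOn_const
    refine (hs.continuousOn_iteratedDerivWithin ?_ (uniqueDiffOn_Ici 1)).mono
      Set.Icc_subset_Ici_self
    exact_mod_cast le_top
  obtain ⟨D, hD⟩ := isCompact_Icc.exists_bound_of_continuousOn hcont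
  refine ⟨|D| * (M + 1) ^ (1 + k) + (k.factorial : ℝ) * |c| * B ^ (k + 1) + 1, by positivity, ?_⟩
  intro r hr
  have hr0 : 0 < r := by linarith
  rw [le_div_iff₀ (by positivity)]
  have t1 : 0 ≤ |D| * (M + 1) ^ (1 + k) := by positivity
  have t2 : 0 ≤ (k.factorial : ℝ) * |c| * B ^ (k + 1) := by positivity
  rcases le_or_gt r (M + 1) with hrM | hrM
  · have h1 := (hD r ⟨hr, hrM⟩).trans (le_abs_self D)
    rw [Real.norm_eq_abs] at h1
    have h2 : r ^ (1 + k) ≤ (M + 1) ^ (1 + k) := by gcongr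
    have := mul_le_mul h1 h2 (by positivity) (by positivity)
    linarith
  · have hMr : M < r := by linarith
    have hp := (hrc r hMr.le).1
    rw [key k r hMr, abs_div, abs_mul, abs_mul, abs_pow, abs_neg, abs_neg, abs_one, one_pow,
      one_mul, abs_of_pos (pow_pos hp _), Nat.abs_cast]
    have h3 : (r / (r + c)) ^ (k + 1) ≤ B ^ (k + 1) := by
      have := hBb r hMr.le
      gcongr
    have h4 : (k.factorial : ℝ) * |c| / (r + c) ^ (k + 1) * r ^ (1 + k)
        = (k.factorial : ℝ) * |c| * (r / (r + c)) ^ (k + 1) := by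
      rw [div_pow, add_comm 1 k]; ring
    rw [h4]
    have := mul_le_mul_of_nonneg_left h3 (show 0 ≤ (k.factorial : ℝ) * |c| by positivity)
    linarith
end

section
/- Let n > 1 and K > 0 be real constants, let Φ_n : ℝ → ℝ be a smooth cutoff function with 0 ≤ Φ_n ≤ 1, Φ_n(r) = 1 for r ≤ n, and Φ_n(r) = 0 for r ≥ n+1, and let h : [1, ∞) → ℝ be the unique positive smooth solution of h'(r) = h(r)/r − (1/r + (1/2) r K Φ_n(r)²) h(r)² with h(1) = a > 0. Then the limit lim_{r→∞} (r/2)(1 − 1/h(r)) exists and equals (n+1)(h(n+1) − 1)/(2 h(n+1)). -/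
open Filter

/-- For the unique positive smooth solution of the cutoff ODE with
`h(1) = a > 0`, the Hawking mass `(r/2)(1 − 1/h(r))` of coordinate spheres converges
as `r → ∞`, with limit `(n+1)(h(n+1) − 1)/(2 h(n+1))`. -/
theorem hawking_mass_limit (n K : ℝ) (hn : 1 < n) (hK : 0 < K)
    (Φ : ℝ → ℝ) (hΦsmooth : ContDiff ℝ (⊤ : ℕ∞) Φ)
    (hΦ0 : ∀ r, 0 ≤ Φ r) (hΦ1 : ∀ r, Φ r ≤ 1)
    (hΦone : ∀ r, r ≤ n → Φ r = 1) (hΦzero : ∀ r, n + 1 ≤ r → Φ r = 0)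
    (a : ℝ) (ha : 0 < a) (h : ℝ → ℝ)
    (hsmooth : ContDiffOn ℝ (⊤ : ℕ∞) h (Set.Ici 1))
    (hinit : h 1 = a)
    (hpos : ∀ r : ℝ, 1 ≤ r → 0 < h r)
    (hode : ∀ r : ℝ, 1 ≤ r →
      HasDerivWithinAt h
        (h r / r - (1 / r + (1 / 2) * r * K * (Φ r) ^ 2) * (h r) ^ 2)
        (Set.Ici 1) r) :
    Tendsto (fun r : ℝ => r / 2 * (1 - 1 / h r)) atTop
      (nhds ((n + 1) * (h (n + 1) - 1) / (2 * h (n + 1)))) := by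
  have hd : ∀ r : ℝ, n + 1 ≤ r →
      HasDerivWithinAt (fun r : ℝ => r / 2 * (1 - 1 / h r)) 0 (Set.Ici (n + 1)) r := by
    intro r hr
    have hr1 : 1 ≤ r := by linarith
    have hr0 : r ≠ 0 := by linarith
    have hh : h r ≠ 0 := (hpos r hr1).ne'
    have h1 := (hode r hr1).mono (Set.Ici_subset_Ici.mpr (by linarith : (1 : ℝ) ≤ n + 1))
    rw [hΦzero r hr] at h1
    have h2 := ((hasDerivWithinAt_id r (Set.Ici (n + 1))).div_const 2).mul
      ((h1.inv hh).const_sub 1)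
    have h3 : (fun r : ℝ => r / 2 * (1 - 1 / h r)) =
        (fun r : ℝ => id r / 2) * (fun r : ℝ => 1 - (h⁻¹) r) := by
      funext x
      simp
    rw [h3]
    refine h2.congr_deriv ?_
    simp only [id, Pi.inv_apply]
    field_simp
    ring
  have hc : ∀ r : ℝ, n + 1 ≤ r →
      r / 2 * (1 - 1 / h r) = (n + 1) / 2 * (1 - 1 / h (n + 1)) := by
    intro r hr
    refine constant_of_has_deriv_right_zero (f := fun r : ℝ => r / 2 * (1 - 1 / h r))
      (a := n + 1) (b := r) ?_ ?_ r ⟨hr, le_rfl⟩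
    · intro x hx
      exact (hd x hx.1).continuousWithinAt.mono Set.Icc_subset_Ici_self
    · intro x hx
      exact (hd x hx.1).mono (Set.Ici_subset_Ici.mpr hx.1)
  have hh : h (n + 1) ≠ 0 := (hpos (n + 1) (by linarith)).ne'
  have he : (n + 1) * (h (n + 1) - 1) / (2 * h (n + 1)) =
      (n + 1) / 2 * (1 - 1 / h (n + 1)) := by
    field_simp
  rw [he]
  refine tendsto_const_nhds.congr' ?_
  filter_upwards [eventually_ge_atTop (n + 1)] with r hr
  exact (hc r hr).symm
end

section
/- Let n > 1 and K > 0 be real constants, let Φ_n : ℝ → ℝ be a smooth cutoff function with 0 ≤ Φ_n ≤ 1, Φ_n(r) = 1 for r ≤ n, and Φ_n(r) = 0 for r ≥ n+1, and let h : [1, ∞) → ℝ be the unique positive smooth solution of h'(r) = h(r)/r − (1/r + (1/2) r K Φ_n(r)²) h(r)² with h(1) = a > 0. Then lim_{r→∞} (r/2)(1 − 1/h(r)) − (1/2)(1 − 1/h(1)) = −∫₀^∞ (1/8) K Φ_n(e^{t/2})² e^{3t/2} dt. -/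
open Filter MeasureTheory

/-- For the unique positive smooth solution of the cutoff ODE with
`h(1) = a > 0`, the total change of the Hawking mass along the inverse mean curvature
flow equals the integral of `(1/8) R(e^{t/2}) e^{3t/2}`:
`lim_{r→∞} (r/2)(1 − 1/h(r)) − (1/2)(1 − 1/h(1)) = −∫₀^∞ (1/8) K Φ(e^{t/2})² e^{3t/2} dt`. -/
theorem hawking_mass_change (n K : ℝ) (hn : 1 < n) (hK : 0 < K)
    (Φ : ℝ → ℝ) (hΦsmooth : ContDiff ℝ (⊤ : ℕ∞) Φ)
    (hΦ0 : ∀ r, 0 ≤ Φ r) (hΦ1 : ∀ r, Φ r ≤ 1)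
    (hΦone : ∀ r, r ≤ n → Φ r = 1) (hΦzero : ∀ r, n + 1 ≤ r → Φ r = 0)
    (a : ℝ) (ha : 0 < a) (h : ℝ → ℝ)
    (hsmooth : ContDiffOn ℝ (⊤ : ℕ∞) h (Set.Ici 1))
    (hinit : h 1 = a)
    (hpos : ∀ r : ℝ, 1 ≤ r → 0 < h r)
    (hode : ∀ r : ℝ, 1 ≤ r →
      HasDerivWithinAt h
        (h r / r - (1 / r + (1 / 2) * r * K * (Φ r) ^ 2) * (h r) ^ 2)
        (Set.Ici 1) r) :
    Tendsto (fun r : ℝ => r / 2 * (1 - 1 / h r) - (1 / 2) * (1 - 1 / h 1)) atTop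
      (nhds (-∫ t in Set.Ioi (0 : ℝ),
        (1 / 8) * K * (Φ (Real.exp (t / 2))) ^ 2 * Real.exp (3 * t / 2))) := by
  set g : ℝ → ℝ := fun t =>
    (1 / 8) * K * (Φ (Real.exp (t / 2))) ^ 2 * Real.exp (3 * t / 2) with hg
  have hΦc : Continuous Φ := hΦsmooth.continuous
  have hgc : Continuous g := by fun_prop
  -- the Hawking mass along the flow has derivative `-g`
  have hder : ∀ t : ℝ, 0 ≤ t → HasDerivWithinAt
      (fun s : ℝ => Real.exp (s / 2) / 2 * (1 - 1 / h (Real.exp (s / 2)))) (-g t)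
      (Set.Ici 0) t := by
    intro t ht
    have h1 : ∀ s : ℝ, 0 ≤ s → 1 ≤ Real.exp (s / 2) := fun s hs =>
      Real.one_le_exp (by linarith)
    have he : HasDerivWithinAt (fun s : ℝ => Real.exp (s / 2))
        (Real.exp (t / 2) * (1 / 2)) (Set.Ici 0) t :=
      (((hasDerivAt_id t).div_const 2).exp).hasDerivWithinAt
    have hh := (hode _ (h1 t ht)).comp t he (fun s hs => h1 s hs)
    have hp := hpos _ (h1 t ht)
    have hm := (he.div_const 2).mul ((hh.inv hp.ne').const_sub 1)
    have hE : Real.exp (3 * t / 2) = Real.exp (t / 2) ^ 3 := by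
      rw [← Real.exp_nat_mul]; congr 1; push_cast; ring
    have hep := Real.exp_pos (t / 2)
    refine (hm.congr_deriv ?_).congr_of_mem (fun s _ => ?_) ht
    · simp only [hg, hE, Function.comp_apply, Pi.inv_apply]
      generalize Real.exp (t / 2) = E at *
      field_simp
      ring
    · simp [one_div]
  have hint : ∀ T : ℝ, 0 ≤ T → ∫ t in (0 : ℝ)..T, g t =
      -(Real.exp (T / 2) / 2 * (1 - 1 / h (Real.exp (T / 2))) - 1 / 2 * (1 - 1 / h 1)) := by
    intro T hT
    have := intervalIntegral.integral_eq_sub_of_hasDeriv_right_of_le hT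
      (fun t ht => ((hder t ht.1).continuousWithinAt.mono Set.Icc_subset_Ici_self))
      (fun t ht => (hder t ht.1.le).mono
        (fun s hs => (ht.1.le.trans (le_of_lt hs) : (0 : ℝ) ≤ s)))
      (hgc.neg.intervalIntegrable 0 T)
    rw [intervalIntegral.integral_neg] at this
    simp only [zero_div, Real.exp_zero] at this
    linarith
  have hgi : IntegrableOn g (Set.Ioi 0) := by
    have hsub : IntegrableOn g (Set.Icc 0 (2 * Real.log (n + 1))) :=
      hgc.integrableOn_Icc
    refine hsub.of_forall_diff_eq_zero measurableSet_Ioi ?_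
    intro t ht
    have h2 : 2 * Real.log (n + 1) < t := by
      by_contra hc
      exact ht.2 ⟨le_of_lt ht.1, not_lt.mp hc⟩
    have h3 : n + 1 ≤ Real.exp (t / 2) := by
      rw [← Real.log_le_iff_le_exp (by linarith)]; linarith
    simp [hg, hΦzero _ h3]
  have hlog : Tendsto (fun r : ℝ => 2 * Real.log r) atTop atTop :=
    Real.tendsto_log_atTop.const_mul_atTop (by norm_num)
  have hlim := (intervalIntegral_tendsto_integral_Ioi 0 hgi hlog).neg
  refine hlim.congr' ?_
  filter_upwards [eventually_ge_atTop (1 : ℝ)] with r hr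
  rw [hint _ (mul_nonneg (by norm_num) (Real.log_nonneg hr))]
  rw [mul_div_cancel_left₀ _ (two_ne_zero), Real.exp_log (by linarith)]
  ring
end

section
/- For each real n > 1 let Φ_n : ℝ → ℝ be a smooth cutoff function with 0 ≤ Φ_n ≤ 1, Φ_n(r) = 1 for r ≤ n, and Φ_n(r) = 0 for r ≥ n+1; set I_n = ∫₀^∞ (1/8) Φ_n(e^{t/2})² e^{3t/2} dt and K_n = (3/4)/I_n > 0. Let h_n : [1, ∞) → ℝ be the unique positive smooth solution of h'(r) = h(r)/r − (1/r + (1/2) r K_n Φ_n(r)²) h(r)² with initial condition h_n(1) = 2/K_n. Then the limit E_n = lim_{r→∞} (r/2)(1 − 1/h_n(r)) exists and equals −1/4 − K_n/4; in particular E_n < 0 < 1/2 for every n > 1, and E_n → −1/4 as n → ∞. -/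
open Filter MeasureTheory

/-- The integrand of `I_n`. -/
noncomputable def pcG (φ : ℝ → ℝ) (t : ℝ) : ℝ :=
  (1 / 8) * (φ (Real.exp (t / 2))) ^ 2 * Real.exp (3 * t / 2)

theorem pcG_continuous {φ : ℝ → ℝ} (hφ : Continuous φ) : Continuous (pcG φ) := by
  unfold pcG; fun_prop

theorem pcG_nonneg (φ : ℝ → ℝ) (t : ℝ) : 0 ≤ pcG φ t := by
  unfold pcG; positivity

theorem pcG_integral {φ : ℝ → ℝ} {n T : ℝ} (hz : ∀ r, n + 1 ≤ r → φ r = 0)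
    (hT : 0 ≤ T) (hnT : n + 1 ≤ Real.exp (T / 2)) :
    ∫ t in Set.Ioi (0 : ℝ), pcG φ t = ∫ t in (0 : ℝ)..T, pcG φ t := by
  rw [intervalIntegral.integral_of_le hT]
  apply setIntegral_eq_of_subset_of_forall_sdiff_eq_zero measurableSet_Ioi
  · exact Set.Ioc_subset_Ioi_self
  · intro t ht
    have h1 : T < t := by
      by_contra hc
      exact ht.2 ⟨ht.1, not_lt.mp hc⟩
    have h2 : Real.exp (T / 2) ≤ Real.exp (t / 2) := Real.exp_le_exp.mpr (by linarith)
    simp [pcG, hz _ (hnT.trans h2)]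

theorem pcG_lower {φ : ℝ → ℝ} (hφ : Continuous φ) {n : ℝ} (hn : 1 < n)
    (h1 : ∀ r, r ≤ n → φ r = 1) (hz : ∀ r, n + 1 ≤ r → φ r = 0) :
    Real.log n / 4 ≤ ∫ t in Set.Ioi (0 : ℝ), pcG φ t := by
  have hlog : 0 < Real.log n := Real.log_pos hn
  have hl : Real.log n ≤ Real.log (n + 1) := Real.log_le_log (by linarith) (by linarith)
  rw [pcG_integral (T := 2 * Real.log (n + 1)) hz (by linarith)
    (by rw [mul_div_cancel_left₀ _ (two_ne_zero), Real.exp_log (by linarith)])]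
  have hc := pcG_continuous hφ
  rw [← intervalIntegral.integral_add_adjacent_intervals
    (hc.intervalIntegrable 0 (2 * Real.log n)) (hc.intervalIntegrable _ _)]
  have hb : 0 ≤ ∫ t in (2 * Real.log n)..(2 * Real.log (n + 1)), pcG φ t :=
    intervalIntegral.integral_nonneg (by linarith) (fun t _ => pcG_nonneg φ t)
  have ha : ∫ t in (0 : ℝ)..(2 * Real.log n), (1 / 8 : ℝ) ≤
      ∫ t in (0 : ℝ)..(2 * Real.log n), pcG φ t := by
    apply intervalIntegral.integral_mono_on (by linarith) (by simp) (hc.intervalIntegrable _ _)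
    intro t ht
    have he : Real.exp (t / 2) ≤ n := by
      rw [← Real.le_log_iff_exp_le (by linarith)]
      linarith [ht.2]
    have h3 : 1 ≤ Real.exp (3 * t / 2) := Real.one_le_exp (by linarith [ht.1])
    simp only [pcG, h1 _ he]
    linarith
  rw [intervalIntegral.integral_const, smul_eq_mul] at ha
  linarith

theorem pc_formula {φ h : ℝ → ℝ} (hφ : Continuous φ) {K : ℝ}
    (hpos : ∀ r : ℝ, 1 ≤ r → 0 < h r)
    (hode : ∀ r : ℝ, 1 ≤ r →
      HasDerivWithinAt h (h r / r - (1 / r + (1 / 2) * r * K * (φ r) ^ 2) * (h r) ^ 2)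
        (Set.Ici 1) r) {T : ℝ} (hT : 0 ≤ T) :
    Real.exp (T / 2) / h (Real.exp (T / 2)) - Real.exp (T / 2) - (1 / h 1 - 1) =
      2 * K * ∫ t in (0 : ℝ)..T, pcG φ t := by
  have key : ∀ t ∈ Set.Ici (0 : ℝ), HasDerivWithinAt
      (fun t => Real.exp (t / 2) / h (Real.exp (t / 2)) - Real.exp (t / 2))
      (2 * K * pcG φ t) (Set.Ici 0) t := by
    intro t ht
    have h1 : 1 ≤ Real.exp (t / 2) := Real.one_le_exp (by linarith [Set.mem_Ici.mp ht])
    have he : HasDerivWithinAt (fun t : ℝ => Real.exp (t / 2)) (Real.exp (t / 2) * (1 / 2))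
        (Set.Ici 0) t :=
      (((hasDerivAt_id t).div_const 2).exp).hasDerivWithinAt
    have hc := (hode _ h1).comp t he (fun s hs => Real.one_le_exp
      (by linarith [Set.mem_Ici.mp hs]))
    have hp := hpos _ h1
    have := (he.div hc hp.ne').sub he
    refine this.congr_deriv ?_
    have e3 : Real.exp (3 * t / 2) = Real.exp (t / 2) ^ 3 := by
      rw [← Real.exp_nat_mul]; congr 1; push_cast; ring
    simp only [pcG, e3, Function.comp]
    have := Real.exp_pos (t / 2)
    generalize Real.exp (t / 2) = x at *
    field_simp
    ring
  have hcont := pcG_continuous hφ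
  have := intervalIntegral.integral_eq_sub_of_hasDeriv_right_of_le hT
    (f := fun t => Real.exp (t / 2) / h (Real.exp (t / 2)) - Real.exp (t / 2))
    (f' := fun t => 2 * K * pcG φ t)
    (fun t ht => ((key t ht.1).continuousWithinAt).mono Set.Icc_subset_Ici_self)
    (fun t ht => (key t ht.1.le).mono
      (fun s hs => Set.mem_Ici.mpr (ht.1.le.trans (le_of_lt hs))))
    ((continuous_const.mul hcont).intervalIntegrable _ _)
  rw [intervalIntegral.integral_const_mul] at this
  rw [this]
  simp

/-- Core computation of the Penrose-inequality counterexample. For each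
`n > 1`, with `I_n = ∫₀^∞ (1/8) Φ_n(e^{t/2})² e^{3t/2} dt`, `K_n = (3/4)/I_n > 0`, and
`h_n` the unique positive smooth solution of the cutoff ODE with `h_n(1) = 2/K_n`
(making the unit sphere a future apparent horizon), the Hawking-mass limit
`E_n = lim_{r→∞} (r/2)(1 − 1/h_n(r))` exists, equals `−1/4 − K_n/4`, satisfies
`E_n < 0 < 1/2`, and `E_n → −1/4` as `n → ∞`. -/
theorem penrose_counterexample_energy (Φ h : ℝ → ℝ → ℝ)
    (hΦsmooth : ∀ n : ℝ, 1 < n → ContDiff ℝ (⊤ : ℕ∞) (Φ n))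
    (hΦ0 : ∀ n : ℝ, 1 < n → ∀ r, 0 ≤ Φ n r)
    (hΦ1 : ∀ n : ℝ, 1 < n → ∀ r, Φ n r ≤ 1)
    (hΦone : ∀ n : ℝ, 1 < n → ∀ r, r ≤ n → Φ n r = 1)
    (hΦzero : ∀ n : ℝ, 1 < n → ∀ r, n + 1 ≤ r → Φ n r = 0)
    (I K : ℝ → ℝ)
    (hI : ∀ n : ℝ, I n =
      ∫ t in Set.Ioi (0 : ℝ), (1 / 8) * (Φ n (Real.exp (t / 2))) ^ 2 * Real.exp (3 * t / 2))
    (hK : ∀ n : ℝ, K n = (3 / 4) / I n)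
    (hsmooth : ∀ n : ℝ, 1 < n → ContDiffOn ℝ (⊤ : ℕ∞) (h n) (Set.Ici 1))
    (hpos : ∀ n : ℝ, 1 < n → ∀ r : ℝ, 1 ≤ r → 0 < h n r)
    (hinit : ∀ n : ℝ, 1 < n → h n 1 = 2 / K n)
    (hode : ∀ n : ℝ, 1 < n → ∀ r : ℝ, 1 ≤ r →
      HasDerivWithinAt (h n)
        (h n r / r - (1 / r + (1 / 2) * r * K n * (Φ n r) ^ 2) * (h n r) ^ 2)
        (Set.Ici 1) r) :
    (∀ n : ℝ, 1 < n → 0 < K n) ∧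
    (∀ n : ℝ, 1 < n →
      Tendsto (fun r : ℝ => r / 2 * (1 - 1 / h n r)) atTop
        (nhds (-1 / 4 - K n / 4)) ∧
      -1 / 4 - K n / 4 < 0 ∧ (0 : ℝ) < 1 / 2) ∧
    Tendsto (fun n : ℝ => -1 / 4 - K n / 4) atTop (nhds (-1 / 4)) := by
  have hIlow : ∀ n : ℝ, 1 < n → Real.log n / 4 ≤ I n := by
    intro n hn
    rw [hI]
    exact pcG_lower (hΦsmooth n hn).continuous hn (hΦone n hn) (hΦzero n hn)
  have hIpos : ∀ n : ℝ, 1 < n → 0 < I n := fun n hn =>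
    lt_of_lt_of_le (by have := Real.log_pos hn; positivity) (hIlow n hn)
  have hKpos : ∀ n : ℝ, 1 < n → 0 < K n := by
    intro n hn
    rw [hK]
    have := hIpos n hn
    positivity
  refine ⟨hKpos, fun n hn => ⟨?_, by linarith [hKpos n hn], by norm_num⟩, ?_⟩
  · apply tendsto_const_nhds.congr'
    filter_upwards [eventually_ge_atTop (n + 1)] with r hr
    have hr0 : 0 < r := by linarith
    have hlog : 0 ≤ Real.log r := Real.log_nonneg (by linarith)
    have hexp : Real.exp (2 * Real.log r / 2) = r := by
      rw [mul_div_cancel_left₀ _ (two_ne_zero), Real.exp_log hr0]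
    have hf := pc_formula (hΦsmooth n hn).continuous (hpos n hn) (hode n hn)
      (T := 2 * Real.log r) (by linarith)
    rw [← pcG_integral (hΦzero n hn) (by linarith) (by rw [hexp]; exact hr), hexp] at hf
    have hIn : ∫ t in Set.Ioi (0 : ℝ), pcG (Φ n) t = I n := (hI n).symm
    have hKI : K n * I n = 3 / 4 := by
      rw [hK, div_mul_cancel₀ _ (hIpos n hn).ne']
    rw [hIn, hinit n hn, one_div_div, mul_assoc, hKI] at hf
    have : r / 2 * (1 - 1 / h n r) = (r - r / h n r) / 2 := by ring
    rw [this]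
    linarith
  · have hItop : Tendsto I atTop atTop := by
      apply tendsto_atTop_mono' atTop (f₁ := fun n => Real.log n / 4)
      · filter_upwards [eventually_gt_atTop 1] with n hn using hIlow n hn
      · exact Real.tendsto_log_atTop.atTop_div_const (by norm_num)
    have hK0 : Tendsto K atTop (nhds 0) := by
      have : K = fun n => (3 / 4) / I n := funext hK
      rw [this]
      exact hItop.const_div_atTop _
    simpa using (hK0.div_const 4).const_sub (-1 / 4)
end

section
/- Let η : ℝ → ℝ be a smooth function with 0 ≤ η ≤ 1 and support contained in the open interval (1, 2), and let ε > 0. Then there exists a unique smooth function h : [1/2, ∞) → ℝ with h(1/2) = 1 satisfying h'(r) = h(r)/r − (1/r + (1/2) r ε η(r)²) h(r)² for all r ≥ 1/2; this solution is positive everywhere and satisfies h(r) = 1 for all r ∈ [1/2, 1]. -/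
/-- For a smooth `η` with `0 ≤ η ≤ 1` supported in `(1, 2)` and `ε > 0`,
the ODE `h'(r) = h(r)/r − (1/r + (1/2) r ε η(r)²) h(r)²` has a unique smooth solution on
`[1/2, ∞)` with `h(1/2) = 1`; it is everywhere positive and equals `1` on `[1/2, 1]`. -/
theorem pmt_counterexample_existence (η : ℝ → ℝ)
    (hηsmooth : ContDiff ℝ (⊤ : ℕ∞) η)
    (hη0 : ∀ r, 0 ≤ η r) (hη1 : ∀ r, η r ≤ 1)
    (hηsupp : Function.support η ⊆ Set.Ioo 1 2)
    (ε : ℝ) (hε : 0 < ε) :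
    ∃ h : ℝ → ℝ,
      (ContDiffOn ℝ (⊤ : ℕ∞) h (Set.Ici (1 / 2)) ∧
        h (1 / 2) = 1 ∧
        (∀ r : ℝ, 1 / 2 ≤ r →
          HasDerivWithinAt h
            (h r / r - (1 / r + (1 / 2) * r * ε * (η r) ^ 2) * (h r) ^ 2)
            (Set.Ici (1 / 2)) r) ∧
        (∀ r : ℝ, 1 / 2 ≤ r → 0 < h r) ∧
        (∀ r : ℝ, 1 / 2 ≤ r → r ≤ 1 → h r = 1)) ∧
      (∀ g : ℝ → ℝ,
        (ContDiffOn ℝ (⊤ : ℕ∞) g (Set.Ici (1 / 2)) ∧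
          g (1 / 2) = 1 ∧
          (∀ r : ℝ, 1 / 2 ≤ r →
            HasDerivWithinAt g
              (g r / r - (1 / r + (1 / 2) * r * ε * (η r) ^ 2) * (g r) ^ 2)
              (Set.Ici (1 / 2)) r)) →
        Set.EqOn g h (Set.Ici (1 / 2))) := by
  have hp : ContDiff ℝ (⊤ : ℕ∞) (fun s : ℝ => (1 / 2) * s ^ 2 * ε * (η s) ^ 2) := by
    fun_prop
  obtain ⟨F, hF⟩ : ∃ F : ℝ → ℝ,
      F = fun r => ∫ s in (1 / 2 : ℝ)..r, (1 / 2) * s ^ 2 * ε * (η s) ^ 2 := ⟨_, rfl⟩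
  have hFd : ∀ r, HasDerivAt F ((1 / 2) * r ^ 2 * ε * (η r) ^ 2) r := by
    intro r
    rw [hF]
    exact (hp.continuous.integral_hasStrictDerivAt (1 / 2) r).hasDerivAt
  have hFs : ContDiff ℝ (⊤ : ℕ∞) F := by
    rw [contDiff_infty_iff_deriv]
    refine ⟨fun r => (hFd r).differentiableAt, ?_⟩
    have : deriv F = fun s : ℝ => (1 / 2) * s ^ 2 * ε * (η s) ^ 2 :=
      funext fun r => (hFd r).deriv
    rw [this]
    exact hp
  have hF0 : F (1 / 2) = 0 := by simp [hF]
  have hFnn : ∀ r : ℝ, 1 / 2 ≤ r → 0 ≤ F r := by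
    intro r hr
    rw [hF]
    exact intervalIntegral.integral_nonneg hr fun s _ => by positivity
  have hF1 : ∀ r : ℝ, 1 / 2 ≤ r → r ≤ 1 → F r = 0 := by
    intro r hr hr1
    rw [hF]
    apply intervalIntegral.integral_zero_ae
    refine Filter.Eventually.of_forall fun s hs => ?_
    rw [Set.uIoc_of_le hr] at hs
    have : η s = 0 := by
      by_contra hne
      have h1 := (hηsupp hne).1
      linarith [hs.2]
    simp [this]
  have hupos : ∀ r : ℝ, 1 / 2 ≤ r → 0 < r + F r := fun r hr => by
    linarith [hFnn r hr]
  refine ⟨fun r => r / (r + F r), ⟨?_, ?_, ?_, ?_, ?_⟩, ?_⟩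
  · refine ContDiffOn.div contDiffOn_id (contDiff_id.add hFs).contDiffOn ?_
    intro r hr
    exact (hupos r hr).ne'
  · show (1 / 2 : ℝ) / (1 / 2 + F (1 / 2)) = 1
    rw [hF0]
    norm_num
  · intro r hr
    have hu := (hupos r hr).ne'
    have hr0 : r ≠ 0 := by linarith
    have hd := ((hasDerivAt_id' r).fun_div ((hasDerivAt_id' r).fun_add (hFd r)) hu).hasDerivWithinAt
      (s := Set.Ici (1 / 2))
    refine hd.congr_deriv ?_
    field_simp
  · intro r hr
    exact div_pos (by linarith) (hupos r hr)
  · intro r hr hr1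
    have : r ≠ 0 := by linarith
    simp [hF1 r hr hr1, this]
  · rintro g ⟨hgs, hg0, hgd⟩ b hb
    have hb' : 1 / 2 ≤ b := hb
    have hgc : ContinuousOn g (Set.Icc (1 / 2) b) :=
      hgs.continuousOn.mono Set.Icc_subset_Ici_self
    have hcc : ContinuousOn
        (fun r => 1 / r - (1 / r + (1 / 2) * r * ε * (η r) ^ 2) * g r)
        (Set.Icc (1 / 2) b) := by
      have hinv : ContinuousOn (fun r : ℝ => 1 / r) (Set.Icc (1 / 2) b) :=
        continuousOn_const.div continuousOn_id fun r hr => by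
          have := hr.1
          linarith
      have hq : Continuous (fun r : ℝ => (1 / 2) * r * ε * (η r) ^ 2) := by
        have := hηsmooth.continuous
        fun_prop
      exact hinv.sub ((hinv.add hq.continuousOn).mul hgc)
    obtain ⟨K, hK⟩ := isCompact_Icc.exists_bound_of_continuousOn hcc
    have hwd : ∀ r ∈ Set.Ico (1 / 2) b, HasDerivWithinAt (fun r => g r * (r + F r) - r)
        ((1 / r - (1 / r + (1 / 2) * r * ε * (η r) ^ 2) * g r) * (g r * (r + F r) - r))
        (Set.Ici r) r := by
      intro r hr
      have hr0 : r ≠ 0 := by linarith [hr.1]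
      have h1 := (hgd r hr.1).mono (Set.Ici_subset_Ici.2 hr.1)
      have h2 := (h1.fun_mul ((hasDerivAt_id' r).fun_add (hFd r)).hasDerivWithinAt).fun_sub
        (hasDerivAt_id' r).hasDerivWithinAt
      refine h2.congr_deriv ?_
      field_simp
      ring
    have hwc : ContinuousOn (fun r => g r * (r + F r) - r) (Set.Icc (1 / 2) b) :=
      (hgc.mul (continuous_id.add hFs.continuous).continuousOn).sub continuousOn_id
    have hgr := norm_le_gronwallBound_of_norm_deriv_right_le (δ := 0) (K := K) (ε := 0)
      hwc hwd (by rw [hF0, hg0]; norm_num) (by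
        intro r hr
        rw [norm_mul, add_zero]
        exact mul_le_mul_of_nonneg_right (hK r ⟨hr.1, hr.2.le⟩) (norm_nonneg _))
      b ⟨hb', le_rfl⟩
    rw [gronwallBound_ε0, zero_mul] at hgr
    have hz := norm_le_zero_iff.1 hgr
    show g b = b / (b + F b)
    rw [eq_div_iff (hupos b hb').ne']
    linarith
end

section
/- Let η : ℝ → ℝ be a smooth function, not identically zero, with 0 ≤ η ≤ 1 and support contained in the open interval (1, 2), let ε > 0, and let h : [1/2, ∞) → ℝ be the unique positive smooth solution of h'(r) = h(r)/r − (1/r + (1/2) r ε η(r)²) h(r)² with h(1/2) = 1. Then lim_{r→∞} (r/2)(1 − 1/h(r)) = −ε ∫₀^∞ (1/8) η(e^{t/2})² e^{3t/2} dt, and this limit is strictly negative. -/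
open Filter MeasureTheory

/-- Core computation of the counterexample to the positive mass theorem:
for a smooth `η ≢ 0` with `0 ≤ η ≤ 1` supported in `(1, 2)`, `ε > 0`, and `h` the unique
positive smooth solution of `h'(r) = h(r)/r − (1/r + (1/2) r ε η(r)²) h(r)²` on
`[1/2, ∞)` with `h(1/2) = 1`, the ADM energy
`lim_{r→∞} (r/2)(1 − 1/h(r)) = −ε ∫₀^∞ (1/8) η(e^{t/2})² e^{3t/2} dt` is strictly
negative. -/
theorem pmt_counterexample_negative_energy (η : ℝ → ℝ)
    (hηsmooth : ContDiff ℝ (⊤ : ℕ∞) η)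
    (hηne : ∃ r : ℝ, η r ≠ 0)
    (hη0 : ∀ r, 0 ≤ η r) (hη1 : ∀ r, η r ≤ 1)
    (hηsupp : Function.support η ⊆ Set.Ioo 1 2)
    (ε : ℝ) (hε : 0 < ε)
    (h : ℝ → ℝ)
    (hsmooth : ContDiffOn ℝ (⊤ : ℕ∞) h (Set.Ici (1 / 2)))
    (hinit : h (1 / 2) = 1)
    (hpos : ∀ r : ℝ, 1 / 2 ≤ r → 0 < h r)
    (hode : ∀ r : ℝ, 1 / 2 ≤ r →
      HasDerivWithinAt h
        (h r / r - (1 / r + (1 / 2) * r * ε * (η r) ^ 2) * (h r) ^ 2)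
        (Set.Ici (1 / 2)) r) :
    Tendsto (fun r : ℝ => r / 2 * (1 - 1 / h r)) atTop
      (nhds (-ε * ∫ t in Set.Ioi (0 : ℝ),
        (1 / 8) * (η (Real.exp (t / 2))) ^ 2 * Real.exp (3 * t / 2))) ∧
    -ε * (∫ t in Set.Ioi (0 : ℝ),
        (1 / 8) * (η (Real.exp (t / 2))) ^ 2 * Real.exp (3 * t / 2)) < 0 := by
  set f : ℝ → ℝ := fun t =>
    (1 / 8) * (η (Real.exp (t / 2))) ^ 2 * Real.exp (3 * t / 2) with hf
  set T : ℝ := 2 * Real.log 2 with hT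
  have hl2 : 0 < Real.log 2 := Real.log_pos (by norm_num)
  have hηc : Continuous η := hηsmooth.continuous
  have hfc : Continuous f := by
    rw [hf]
    fun_prop
  have hfsupp : Function.support f ⊆ Set.Ioo 0 T := by
    intro t ht
    have h1 : η (Real.exp (t / 2)) ≠ 0 := by
      intro h0
      apply ht
      simp [hf, h0]
    have h2 := hηsupp h1
    have h3 : 0 < t / 2 := Real.one_lt_exp_iff.1 h2.1
    have h4 : t / 2 < Real.log 2 := (Real.lt_log_iff_exp_lt (by norm_num)).2 h2.2
    constructor
    · linarith
    · rw [hT]; linarith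
  have hcomp : HasCompactSupport f := by
    refine HasCompactSupport.intro (isCompact_Icc (a := 0) (b := T)) ?_
    intro t ht
    by_contra h0
    exact ht (Set.Ioo_subset_Icc_self (hfsupp h0))
  have hI : ∫ t in Set.Ioi (0 : ℝ), f t = ∫ t, f t := by
    apply setIntegral_eq_integral_of_forall_compl_eq_zero
    intro t ht
    by_contra h0
    exact ht (hfsupp h0).1
  have hIpos : 0 < ∫ t, f t := by
    obtain ⟨r, hr⟩ := hηne
    have hr1 := (hηsupp hr).1
    refine hfc.integral_pos_of_hasCompactSupport_nonneg_nonzero hcomp ?_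
      (x := 2 * Real.log r) ?_
    · intro t
      simp only [hf, Pi.zero_apply]
      positivity
    · have h1 : Real.exp (2 * Real.log r / 2) = r := by
        rw [mul_div_cancel_left₀ _ (by norm_num : (2 : ℝ) ≠ 0), Real.exp_log (by linarith)]
      simp only [hf, h1]
      have := Real.exp_pos (3 * (2 * Real.log r) / 2)
      positivity
  rw [hI]
  refine ⟨?_, by nlinarith⟩
  -- the mass function
  set m : ℝ → ℝ := fun r => r / 2 * (1 - 1 / h r) with hm
  have hmd : ∀ r : ℝ, 1 / 2 < r → HasDerivAt m (-ε * (r ^ 2 * η r ^ 2 / 4)) r := by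
    intro r hr
    have hp := hpos r hr.le
    have h1 := (hode r hr.le).hasDerivAt (Ici_mem_nhds hr)
    have h2 := ((hasDerivAt_id r).div_const 2).mul ((h1.inv hp.ne').const_sub 1)
    have h3 : m = (fun x => id x / 2) * (fun x => 1 - (h⁻¹) x) := by
      ext x; simp [hm]
    rw [h3]
    refine h2.congr_deriv ?_
    have hr0 : r ≠ 0 := by linarith
    have hp0 := hp.ne'
    simp only [id, Pi.inv_apply]
    field_simp
    ring
  have hmc : ContinuousOn m (Set.Ici (1 / 2)) := by
    have := hsmooth.continuousOn
    rw [hm]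
    refine (by fun_prop : ContinuousOn (fun r : ℝ => r / 2) _).mul
      (continuousOn_const.sub (continuousOn_const.div this ?_))
    intro r hr
    exact (hpos r hr).ne'
  have hexpT : Real.exp (-T / 2) = 1 / 2 := by
    have : -T / 2 = -Real.log 2 := by rw [hT]; ring
    rw [this, Real.exp_neg, Real.exp_log (by norm_num)]
    norm_num
  have key : ∀ x : ℝ, T ≤ x → m (Real.exp (x / 2)) = -ε * ∫ t, f t := by
    intro x hx
    have hle : -T ≤ x := by linarith
    have hF := intervalIntegral.integral_eq_sub_of_hasDerivAt_of_le
      (f := fun t => m (Real.exp (t / 2))) (f' := fun t => -ε * f t) hle ?_ ?_ ?_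
    · rw [intervalIntegral.integral_const_mul,
        intervalIntegral.integral_eq_integral_of_support_subset] at hF
      · simp only [hexpT] at hF
        have : m (1 / 2) = 0 := by simp only [hm, hinit]; norm_num
        rw [this] at hF
        linarith
      · intro t ht
        have := hfsupp ht
        constructor
        · linarith [this.1]
        · linarith [this.2]
    · refine hmc.comp (by fun_prop) ?_
      intro t ht
      change 1 / 2 ≤ Real.exp (t / 2)
      rw [← hexpT]
      apply Real.exp_le_exp.2
      linarith [ht.1]
    · intro t ht
      have h1 : 1 / 2 < Real.exp (t / 2) := by
        rw [← hexpT]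
        apply Real.exp_lt_exp.2
        linarith [ht.1]
      have h2 := (hmd _ h1).comp t (((hasDerivAt_id t).div_const 2).exp)
      refine h2.congr_deriv ?_
      have h3 : Real.exp (3 * t / 2) = Real.exp (t / 2) ^ 3 := by
        rw [← Real.exp_nat_mul]
        congr 1
        push_cast
        ring
      simp only [hf, h3, id]
      ring
    · exact (hfc.const_mul (-ε)).intervalIntegrable _ _
  refine tendsto_const_nhds.congr' ?_
  filter_upwards [eventually_ge_atTop 2] with r hr
  have h1 := key (2 * Real.log r) (by
    rw [hT]
    have := Real.log_le_log (by norm_num) hr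
    linarith)
  rw [mul_div_cancel_left₀ _ (by norm_num : (2 : ℝ) ≠ 0), Real.exp_log (by linarith)] at h1
  exact h1.symm
end
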